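/- In the cyclic-row construction of Example 1 with uniform row sampling (p_l = 1/n for all l), for any fixed C ∈ ℝ^{d×d}, if L_n is a uniformly distributed random index on {1,…,n} then var( a_{L_n}ᵀ C a_{L_n} ) → ℓ(C) := (1/d) Σ_{l=1}^d (a_lᵀ C a_l)² − ( (1/d) Σ_{l=1}^d a_lᵀ C a_l )² as n → ∞. Moreover, if (λ₁, 𝗏₁) and (λ₂, 𝗏₂) are eigenpairs of G∘ with unit orthogonal eigenvectors, then ℓ(𝗏₁𝗏₁ᵀ) = λ₁² ( d Σ_{l=1}^d (e_lᵀ𝗏₁)⁴ − 1 ) and ℓ(𝗏₁𝗏₂ᵀ) = λ₁λ₂ d Σ_{l=1}^d (e_lᵀ𝗏₁)² (e_lᵀ𝗏₂)². -/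

import Mathlib

open Matrix Filter Topology MeasureTheory ProbabilityTheory
open scoped ENNReal

noncomputable section

namespace CyclicRowsVariance

/-- The cyclically repeated rows `a_l` of `√d·Q` (0-based index `l`). -/
def cycRow (d : ℕ) (hd : 0 < d) (Q : Matrix (Fin d) (Fin d) ℝ) (l : ℕ) : Fin d → ℝ :=
  fun j => Real.sqrt d * Q ⟨l % d, Nat.mod_lt _ hd⟩ j

/-- The limit function `ℓ(C) = (1/d)Σ_{l=1}^d (a_lᵀCa_l)² − ((1/d)Σ_{l=1}^d a_lᵀCa_l)²`. -/
def ellFun (d : ℕ) (hd : 0 < d) (Q : Matrix (Fin d) (Fin d) ℝ)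
    (C : Matrix (Fin d) (Fin d) ℝ) : ℝ :=
  (1 / (d : ℝ)) * ∑ l : Fin d, (cycRow d hd Q l.val ⬝ᵥ (C *ᵥ cycRow d hd Q l.val)) ^ 2 -
    ((1 / (d : ℝ)) * ∑ l : Fin d, cycRow d hd Q l.val ⬝ᵥ (C *ᵥ cycRow d hd Q l.val)) ^ 2

/-- The uniform probability measure on `Fin n`. -/
def uniformFin (n : ℕ) : Measure (Fin n) :=
  ((n : ℝ≥0∞))⁻¹ • Measure.count

/-- Cesàro means of a periodic sequence converge to the mean over one period. -/
theorem tendsto_cesaro_of_periodic {d : ℕ} (hd : 0 < d) {f : ℕ → ℝ}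
    (hf : Function.Periodic f d) :
    Tendsto (fun n : ℕ => (n : ℝ)⁻¹ * ∑ i ∈ Finset.range n, f i) atTop
      (𝓝 ((1 / (d : ℝ)) * ∑ i ∈ Finset.range d, f i)) := by
  have hd0 : (d : ℝ) ≠ 0 := by positivity
  set m := (1 / (d : ℝ)) * ∑ i ∈ Finset.range d, f i with hm
  set S : ℕ → ℝ := fun n => ∑ i ∈ Finset.range n, (f i - m) with hS
  have hSd : S d = 0 := by
    simp only [hS, Finset.sum_sub_distrib, Finset.sum_const, Finset.card_range, nsmul_eq_mul, hm]
    field_simp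
    ring
  have hper : Function.Periodic S d := fun n => by
    have h : S (d + n) = S d + S n := by
      simp only [hS, Finset.sum_range_add]
      congr 1
      exact Finset.sum_congr rfl fun i _ => by rw [add_comm d i, hf i]
    rw [add_comm, h, hSd, zero_add]
  have hbound : ∀ n, |S n| ≤ ∑ i ∈ Finset.range d, |S i| := fun n => by
    rw [← hper.map_mod_nat n]
    exact Finset.single_le_sum (f := fun i => |S i|) (fun i _ => abs_nonneg _)
      (Finset.mem_range.2 (Nat.mod_lt n hd))
  have hlim : Tendsto (fun n : ℕ => (n : ℝ)⁻¹ * S n) atTop (𝓝 0) := by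
    refine squeeze_zero_norm (a := fun n : ℕ => (n : ℝ)⁻¹ * ∑ i ∈ Finset.range d, |S i|)
      (fun n => ?_) ?_
    · rw [norm_mul, Real.norm_eq_abs, Real.norm_eq_abs, abs_of_nonneg (by positivity)]
      exact mul_le_mul_of_nonneg_left (hbound n) (by positivity)
    · simpa using (tendsto_inv_atTop_nhds_zero_nat (𝕜 := ℝ)).mul_const _
  have hsum : Tendsto (fun n : ℕ => (n : ℝ)⁻¹ * S n + m) atTop (𝓝 m) := by
    simpa using hlim.add_const m
  refine hsum.congr' ?_
  filter_upwards [eventually_gt_atTop 0] with n hn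
  have hn0 : (n : ℝ) ≠ 0 := by positivity
  simp only [hS, Finset.sum_sub_distrib, Finset.sum_const, Finset.card_range, nsmul_eq_mul]
  field_simp
  ring

theorem isProbabilityMeasure_uniformFin {n : ℕ} (hn : 0 < n) :
    IsProbabilityMeasure (uniformFin n) := by
  constructor
  rw [uniformFin, Measure.smul_apply, Measure.count_univ, smul_eq_mul]
  simp only [ENat.card_eq_coe_fintype_card, Fintype.card_fin]
  exact ENNReal.inv_mul_cancel (by simpa using hn.ne') (by simp)

theorem integral_uniformFin (n : ℕ) (f : ℕ → ℝ) :
    ∫ l : Fin n, f l ∂(uniformFin n) = (n : ℝ)⁻¹ * ∑ i ∈ Finset.range n, f i := by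
  rw [uniformFin, integral_smul_measure, integral_count, ← Fin.sum_univ_eq_sum_range]
  simp

theorem variance_uniformFin {n : ℕ} (hn : 0 < n) (f : ℕ → ℝ) :
    variance (fun l : Fin n => f l) (uniformFin n) =
      (n : ℝ)⁻¹ * ∑ i ∈ Finset.range n, f i ^ 2 -
        ((n : ℝ)⁻¹ * ∑ i ∈ Finset.range n, f i) ^ 2 := by
  have := isProbabilityMeasure_uniformFin hn
  rw [variance_eq_sub MemLp.of_discrete, integral_uniformFin, ← integral_uniformFin n (f · ^ 2)]
  rfl

theorem tendsto_variance_of_periodic {d : ℕ} (hd : 0 < d) {f : ℕ → ℝ}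
    (hf : Function.Periodic f d) :
    Tendsto (fun n : ℕ => variance (fun l : Fin n => f l) (uniformFin n)) atTop
      (𝓝 ((1 / (d : ℝ)) * ∑ l : Fin d, f l ^ 2 - ((1 / (d : ℝ)) * ∑ l : Fin d, f l) ^ 2)) := by
  rw [Fin.sum_univ_eq_sum_range f, Fin.sum_univ_eq_sum_range (f · ^ 2)]
  have hsq : Function.Periodic (f · ^ 2) d := fun n => by simp only [hf n]
  refine ((tendsto_cesaro_of_periodic hd hsq).sub
    ((tendsto_cesaro_of_periodic hd hf).pow 2)).congr' ?_
  filter_upwards [eventually_gt_atTop 0] with n hn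
  exact (variance_uniformFin hn f).symm

theorem cycRow_periodic (d : ℕ) (hd : 0 < d) (Q : Matrix (Fin d) (Fin d) ℝ) :
    Function.Periodic (cycRow d hd Q) d := fun l => by
  funext j
  simp only [cycRow, Nat.add_mod_right]

/-- An eigenvector of the square of a positive definite matrix is an eigenvector of the matrix,
for the square root of the eigenvalue. -/
theorem mulVec_eq_sqrt_smul {ι : Type*} [Fintype ι] {Q : Matrix ι ι ℝ} (hQ : Q.PosDef)
    {lam : ℝ} (hlam : 0 ≤ lam) {v : ι → ℝ} (hv : (Q * Q) *ᵥ v = lam • v) :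
    Q *ᵥ v = √lam • v := by
  by_contra hne
  have hw : Q *ᵥ v - √lam • v ≠ 0 := sub_ne_zero.2 hne
  set w := Q *ᵥ v - √lam • v with hwdef
  have hQw : Q *ᵥ w = -√lam • w := by
    rw [hwdef, mulVec_sub, mulVec_smul, mulVec_mulVec, hv, smul_sub, smul_smul, neg_mul,
      Real.mul_self_sqrt hlam]
    module
  have hpos := hQ.dotProduct_mulVec_pos hw
  rw [hQw, dotProduct_smul, smul_eq_mul, neg_mul, star_trivial] at hpos
  have hww : 0 ≤ w ⬝ᵥ w := Finset.sum_nonneg fun i _ => mul_self_nonneg _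
  nlinarith [Real.sqrt_nonneg lam]

theorem eigenvalue_nonneg_of_posDef {ι : Type*} [Fintype ι] {G : Matrix ι ι ℝ} (hG : G.PosDef)
    {lam : ℝ} {v : ι → ℝ} (hunit : v ⬝ᵥ v = 1) (hv : G *ᵥ v = lam • v) : 0 ≤ lam := by
  have h := hG.posSemidef.dotProduct_mulVec_nonneg v
  rwa [hv, dotProduct_smul, star_trivial, hunit, smul_eq_mul, mul_one] at h

theorem cycRow_dotProduct {d : ℕ} (hd : 0 < d) {Q : Matrix (Fin d) (Fin d) ℝ} {c : ℝ}
    {v : Fin d → ℝ} (hv : Q *ᵥ v = c • v) (l : Fin d) :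
    cycRow d hd Q l ⬝ᵥ v = √d * (c * v l) := by
  have h := congrFun hv l
  simp only [mulVec, dotProduct, Pi.smul_apply, smul_eq_mul] at h
  simp only [dotProduct, cycRow, Nat.mod_eq_of_lt l.isLt, Fin.eta, mul_assoc, ← Finset.mul_sum, h]

/-- The limit function at the rank-one matrix of two eigenvectors. -/
theorem ellFun_vecMulVec {d : ℕ} (hd : 0 < d) {Q : Matrix (Fin d) (Fin d) ℝ} {c₁ c₂ : ℝ}
    {v₁ v₂ : Fin d → ℝ} (hv₁ : Q *ᵥ v₁ = c₁ • v₁) (hv₂ : Q *ᵥ v₂ = c₂ • v₂) :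
    ellFun d hd Q (vecMulVec v₁ v₂) =
      c₁ ^ 2 * c₂ ^ 2 * (d * ∑ l, v₁ l ^ 2 * v₂ l ^ 2 - (v₁ ⬝ᵥ v₂) ^ 2) := by
  have hd0 : (d : ℝ) ≠ 0 := by positivity
  have hs : √(d : ℝ) ^ 2 = d := Real.sq_sqrt (by positivity)
  have hq : ∀ l : Fin d, cycRow d hd Q l ⬝ᵥ (vecMulVec v₁ v₂ *ᵥ cycRow d hd Q l) =
      d * (c₁ * c₂) * (v₁ l * v₂ l) := fun l => by
    rw [vecMulVec_mulVec, op_smul_eq_smul, dotProduct_smul, smul_eq_mul, dotProduct_comm v₂,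
      cycRow_dotProduct hd hv₁, cycRow_dotProduct hd hv₂]
    linear_combination (c₁ * c₂ * (v₁ l * v₂ l)) * hs
  simp only [ellFun, hq, mul_pow, ← Finset.mul_sum]
  rw [dotProduct]
  field_simp

/-- Example 1, uniform sampling: in the cyclic-row construction with uniform
row sampling, for a uniformly distributed random index `L_n` on `{1,…,n}`,
`var(a_{L_n}ᵀ C a_{L_n}) → ℓ(C)` as `n → ∞` for every fixed `C`; moreover, for eigenpairs
`(λ₁,𝗏₁)`, `(λ₂,𝗏₂)` of `G∘` with unit orthogonal eigenvectors,
`ℓ(𝗏₁𝗏₁ᵀ) = λ₁²(dΣ_l(e_lᵀ𝗏₁)⁴ − 1)` and `ℓ(𝗏₁𝗏₂ᵀ) = λ₁λ₂ d Σ_l (e_lᵀ𝗏₁)²(e_lᵀ𝗏₂)²`. -/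
theorem cyclic_row_variance_limit
    (d : ℕ) (hd : 0 < d)
    (G0 : Matrix (Fin d) (Fin d) ℝ) (hG0 : G0.PosDef)
    (Q : Matrix (Fin d) (Fin d) ℝ) (hQ : Q.PosDef) (hQG : Q * Q = G0)
    (lam₁ lam₂ : ℝ) (v₁ v₂ : Fin d → ℝ)
    (hv₁ : v₁ ≠ 0) (hv₂ : v₂ ≠ 0)
    (heig₁ : G0 *ᵥ v₁ = lam₁ • v₁) (heig₂ : G0 *ᵥ v₂ = lam₂ • v₂)
    (hunit₁ : v₁ ⬝ᵥ v₁ = 1) (hunit₂ : v₂ ⬝ᵥ v₂ = 1) (horth : v₁ ⬝ᵥ v₂ = 0) :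
    (∀ C : Matrix (Fin d) (Fin d) ℝ,
      Tendsto (fun n : ℕ =>
          variance (fun l : Fin n => cycRow d hd Q l.val ⬝ᵥ (C *ᵥ cycRow d hd Q l.val))
            (uniformFin n))
        atTop (𝓝 (ellFun d hd Q C))) ∧
    ellFun d hd Q (vecMulVec v₁ v₁) =
      lam₁ ^ 2 * ((d : ℝ) * ∑ l : Fin d, (v₁ l) ^ 4 - 1) ∧
    ellFun d hd Q (vecMulVec v₁ v₂) =
      lam₁ * lam₂ * (d : ℝ) * ∑ l : Fin d, (v₁ l) ^ 2 * (v₂ l) ^ 2 := by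
  have hlam₁ := eigenvalue_nonneg_of_posDef hG0 hunit₁ heig₁
  have hlam₂ := eigenvalue_nonneg_of_posDef hG0 hunit₂ heig₂
  subst hQG
  have hQ₁ := mulVec_eq_sqrt_smul hQ hlam₁ heig₁
  have hQ₂ := mulVec_eq_sqrt_smul hQ hlam₂ heig₂
  refine ⟨fun C => ?_, ?_, ?_⟩
  · exact tendsto_variance_of_periodic hd
      (f := fun l => cycRow d hd Q l ⬝ᵥ (C *ᵥ cycRow d hd Q l))
      fun l => by simp only [cycRow_periodic d hd Q l]
  · rw [ellFun_vecMulVec hd hQ₁ hQ₁, hunit₁, Real.sq_sqrt hlam₁]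
    simp only [← pow_add, one_pow, Nat.reduceAdd]
    ring
  · rw [ellFun_vecMulVec hd hQ₁ hQ₂, horth, Real.sq_sqrt hlam₁, Real.sq_sqrt hlam₂]
    ring

end CyclicRowsVariance

end
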